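/- arXiv:1410.3520 — 4 statements merged into one kernel-verified Lean document; each statement's English description precedes it below -/
import Mathlib

section
/- Let p_1 < p_2 < p_3 < … denote the sequence of prime numbers in increasing order. Let χ be a Dirichlet character and let s = σ + it with σ > 1/2. If there exists C > 0 such that |∑_{n=1}^N χ(p_n) p_n^{-it}| ≤ C·√N for every N ≥ 1, then the sequence log 𝒫_N(s,χ) := −∑_{n=1}^N Log(1 − χ(p_n) p_n^{-s}) (where Log is the principal branch of the complex logarithm; each term is well defined since |χ(p_n) p_n^{-s}| < 1) converges as N → ∞, and consequently its Cesàro averages (1/N)·∑_{M=1}^N log 𝒫_M(s,χ) converge to the same limit. -/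
open Complex Filter Finset

/-- Abel summation with the boundary term at the upper end of the range. -/
lemma sum_range_smul_eq_smul_add_sum {E : Type*} [AddCommGroup E] [Module ℝ E]
    (b : ℕ → ℝ) (z : ℕ → E) (N : ℕ) :
    ∑ n ∈ range N, b n • z n = b N • ∑ n ∈ range N, z n +
      ∑ n ∈ range N, (b n - b (n + 1)) • ∑ m ∈ range (n + 1), z m := by
  induction N with
  | zero => simp
  | succ N ih =>
    rw [sum_range_succ, ih, sum_range_succ (fun n => (b n - b (n + 1)) • _),
      sum_range_succ z, smul_add, smul_add, sub_smul, sub_smul]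
    abel

lemma sqrt_add_one_sub_sqrt_le (n : ℕ) :
    √((n : ℝ) + 1) - √n ≤ ((n : ℝ) + 1) ^ (-(1 / 2) : ℝ) := by
  have hn : (0 : ℝ) ≤ n := n.cast_nonneg
  have hpos : 0 < √((n : ℝ) + 1) := Real.sqrt_pos.2 (by positivity)
  rw [Real.rpow_neg (by positivity), ← Real.sqrt_eq_rpow, ← one_div, le_div_iff₀ hpos]
  nlinarith [Real.sq_sqrt hn, Real.sq_sqrt (show (0 : ℝ) ≤ n + 1 by positivity),
    Real.sqrt_nonneg (n : ℝ), Real.sqrt_le_sqrt (show (n : ℝ) ≤ n + 1 by linarith)]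

lemma summable_nat_add_one_rpow {r : ℝ} (hr : r < -1) :
    Summable fun n : ℕ => ((n : ℝ) + 1) ^ r := by
  simpa using (summable_nat_add_iff 1).2 (Real.summable_nat_rpow.2 hr)

lemma tendsto_sqrt_mul_of_le_rpow {σ : ℝ} (hσ : 1 / 2 < σ) {b : ℕ → ℝ} (hb0 : ∀ n, 0 ≤ b n)
    (hb : ∀ n : ℕ, b n ≤ ((n : ℝ) + 1) ^ (-σ)) :
    Tendsto (fun n : ℕ => √(n : ℝ) * b n) atTop (nhds 0) := by
  have hlim : Tendsto (fun n : ℕ => ((n : ℝ) + 1) ^ (-(σ - 1 / 2))) atTop (nhds 0) :=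
    (tendsto_rpow_neg_atTop (by linarith)).comp
      (tendsto_atTop_add_const_right _ 1 tendsto_natCast_atTop_atTop)
  refine squeeze_zero (fun n => mul_nonneg (Real.sqrt_nonneg _) (hb0 n)) (fun n => ?_) hlim
  have hn : (0 : ℝ) < n + 1 := by positivity
  calc √(n : ℝ) * b n ≤ √((n : ℝ) + 1) * ((n : ℝ) + 1) ^ (-σ) :=
        mul_le_mul (Real.sqrt_le_sqrt (by linarith)) (hb n) (hb0 n) (Real.sqrt_nonneg _)
    _ = ((n : ℝ) + 1) ^ (-(σ - 1 / 2)) := by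
        rw [Real.sqrt_eq_rpow, ← Real.rpow_add hn]
        ring_nf

lemma summable_sqrt_mul_sub_of_le_rpow {σ : ℝ} (hσ : 1 / 2 < σ) {b : ℕ → ℝ}
    (hanti : Antitone b) (hb0 : ∀ n, 0 ≤ b n)
    (hb : ∀ n : ℕ, b n ≤ ((n : ℝ) + 1) ^ (-σ)) :
    Summable fun n : ℕ => √((n : ℝ) + 1) * (b n - b (n + 1)) := by
  have hdiff (n : ℕ) : 0 ≤ √((n : ℝ) + 1) - √n :=
    sub_nonneg.2 (Real.sqrt_le_sqrt (by linarith))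
  have hsum : Summable fun n : ℕ => (√((n : ℝ) + 1) - √n) * b n := by
    refine (summable_nat_add_one_rpow (r := -(1 / 2) + -σ) (by linarith)).of_nonneg_of_le
      (fun n => mul_nonneg (hdiff n) (hb0 n)) fun n => ?_
    rw [Real.rpow_add (by positivity)]
    exact mul_le_mul (sqrt_add_one_sub_sqrt_le n) (hb n) (hb0 n) (by positivity)
  have habel (N : ℕ) : ∑ n ∈ range N, √((n : ℝ) + 1) * (b n - b (n + 1)) + √(N : ℝ) * b N =
      ∑ n ∈ range N, (√((n : ℝ) + 1) - √n) * b n := by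
    induction N with
    | zero => simp
    | succ N ih =>
      rw [sum_range_succ, sum_range_succ, ← ih]
      push_cast
      ring
  refine summable_of_sum_range_le
    (fun n => mul_nonneg (Real.sqrt_nonneg _) (sub_nonneg.2 (hanti n.le_succ)))
    (c := ∑' n : ℕ, (√((n : ℝ) + 1) - √n) * b n) fun N => ?_
  have hle := hsum.sum_le_tsum (range N) fun n _ => mul_nonneg (hdiff n) (hb0 n)
  linarith [habel N, mul_nonneg (Real.sqrt_nonneg (N : ℝ)) (hb0 N)]

/-- A Dirichlet test: partial sums of size `O(√N)` against monotone weights of size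
`O(N ^ (-σ))` with `σ > 1/2`. -/
lemma exists_tendsto_sum_smul_of_norm_sum_le_sqrt {E : Type*} [NormedAddCommGroup E]
    [NormedSpace ℝ E] [CompleteSpace E] {σ C : ℝ} (hσ : 1 / 2 < σ) {b : ℕ → ℝ}
    (hanti : Antitone b) (hb0 : ∀ n, 0 ≤ b n)
    (hb : ∀ n : ℕ, b n ≤ ((n : ℝ) + 1) ^ (-σ)) {z : ℕ → E}
    (hz : ∀ N : ℕ, 1 ≤ N → ‖∑ n ∈ range N, z n‖ ≤ C * √(N : ℝ)) :
    ∃ L : E, Tendsto (fun N : ℕ => ∑ n ∈ range N, b n • z n) atTop (nhds L) := by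
  have hbdry : Tendsto (fun N : ℕ => b N • ∑ n ∈ range N, z n) atTop (nhds 0) := by
    refine squeeze_zero_norm' ?_
      (by simpa using (tendsto_sqrt_mul_of_le_rpow hσ hb0 hb).const_mul C)
    filter_upwards [eventually_ge_atTop 1] with N hN
    rw [norm_smul, Real.norm_of_nonneg (hb0 N)]
    exact (mul_le_mul_of_nonneg_left (hz N hN) (hb0 N)).trans_eq (by ring)
  have hsum : Summable fun n : ℕ => (b n - b (n + 1)) • ∑ m ∈ range (n + 1), z m := by
    refine .of_norm_bounded
      ((summable_sqrt_mul_sub_of_le_rpow hσ hanti hb0 hb).mul_left C) fun n => ?_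
    have hn := sub_nonneg.2 (hanti n.le_succ)
    have hzn := hz (n + 1) n.succ_pos
    push_cast at hzn
    rw [norm_smul, Real.norm_of_nonneg hn]
    exact (mul_le_mul_of_nonneg_left hzn hn).trans_eq (by ring)
  refine ⟨_, (hbdry.add hsum.hasSum.tendsto_sum_nat).congr fun N => ?_⟩
  exact (sum_range_smul_eq_smul_add_sum b z N).symm

/-- If `∑ w n` converges and `∑ ‖w n‖ ^ 2` does too, then so does `∑ log (1 - w n)`. -/
lemma exists_tendsto_neg_sum_log_one_sub {w : ℕ → ℂ} {L : ℂ}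
    (hw : Tendsto (fun N : ℕ => ∑ n ∈ range N, w n) atTop (nhds L))
    (hsq : Summable fun n => ‖w n‖ ^ 2) :
    ∃ L' : ℂ, Tendsto (fun N : ℕ => -∑ n ∈ range N, log (1 - w n)) atTop (nhds L') := by
  have hw0 : Tendsto w atTop (nhds 0) := by
    rw [tendsto_zero_iff_norm_tendsto_zero]
    simpa using hsq.tendsto_atTop_zero.sqrt
  have hO : (fun n => log (1 - w n) + w n) =O[atTop] fun n => ‖w n‖ ^ 2 := by
    have hneg : Tendsto (fun n => -w n) atTop (nhds 0) := by simpa using hw0.neg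
    simpa [Function.comp_def, sub_eq_add_neg] using
      (log_sub_self_isBigO.comp_tendsto hneg).norm_right
  have hsum : Summable fun n => log (1 - w n) + w n := summable_of_isBigO_nat hsq hO
  refine ⟨_, (hw.sub hsum.hasSum.tendsto_sum_nat).congr fun N => ?_⟩
  rw [sum_add_distrib]
  ring

/-- with `p n = Nat.nth Nat.Prime n` the increasing sequence of primes,
`χ` a Dirichlet character, `s = σ + it` with `σ > 1/2`, and assuming the √N bound on the
partial sums `∑_{n<N} χ(p n) (p n)^{-it}`, the sequence
`log 𝒫_N(s,χ) = -∑_{n<N} Log(1 - χ(p n) (p n)^{-s})` converges to some `L`, and its Cesàro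
averages `(1/N) ∑_{M=1}^{N} log 𝒫_M(s,χ)` converge to the same `L`. -/
theorem stmt_1 {k : ℕ} (χ : DirichletCharacter ℂ k) (σ t : ℝ) (hσ : 1 / 2 < σ)
    (hbound : ∃ C : ℝ, 0 < C ∧ ∀ N : ℕ, 1 ≤ N →
      ‖∑ n ∈ Finset.range N,
          χ (Nat.nth Nat.Prime n) * (Nat.nth Nat.Prime n : ℂ) ^ (-(I * (t : ℂ)))‖
        ≤ C * Real.sqrt N) :
    ∃ L : ℂ,
      Tendsto (fun N : ℕ => -∑ n ∈ Finset.range N,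
          Complex.log (1 - χ (Nat.nth Nat.Prime n) *
            (Nat.nth Nat.Prime n : ℂ) ^ (-((σ : ℂ) + I * (t : ℂ)))))
        atTop (nhds L) ∧
      Tendsto (fun N : ℕ => (N : ℂ)⁻¹ * ∑ M ∈ Finset.range N,
          (-∑ n ∈ Finset.range (M + 1),
            Complex.log (1 - χ (Nat.nth Nat.Prime n) *
              (Nat.nth Nat.Prime n : ℂ) ^ (-((σ : ℂ) + I * (t : ℂ))))))
        atTop (nhds L) := by
  obtain ⟨C, -, hC⟩ := hbound
  set p : ℕ → ℕ := Nat.nth Nat.Prime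
  set z : ℕ → ℂ := fun n => χ (p n) * (p n : ℂ) ^ (-(I * (t : ℂ))) with hzdef
  set b : ℕ → ℝ := fun n => (p n : ℝ) ^ (-σ) with hbdef
  have hp_pos (n : ℕ) : 0 < p n := (Nat.prime_nth_prime n).pos
  have hp_le (n : ℕ) : (n : ℝ) + 1 ≤ p n := by
    exact_mod_cast (Nat.le_succ _).trans (Nat.add_two_le_nth_prime n)
  have hanti : Antitone b := fun m n hmn =>
    Real.rpow_le_rpow_of_nonpos (by exact_mod_cast hp_pos m)
      (by exact_mod_cast (Nat.nth_strictMono Nat.infinite_setOfPred_prime).monotone hmn)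
      (by linarith)
  have hb0 (n : ℕ) : 0 ≤ b n := by positivity
  have hb (n : ℕ) : b n ≤ ((n : ℝ) + 1) ^ (-σ) :=
    Real.rpow_le_rpow_of_nonpos (by positivity) (hp_le n) (by linarith)
  have hbz (n : ℕ) : b n • z n = χ (p n) * (p n : ℂ) ^ (-((σ : ℂ) + I * (t : ℂ))) := by
    have hpn : (p n : ℂ) ≠ 0 := by exact_mod_cast (hp_pos n).ne'
    rw [real_smul, hbdef, hzdef, ofReal_cpow (by positivity), neg_add, cpow_add _ _ hpn]
    push_cast
    ring
  have hznorm (n : ℕ) : ‖z n‖ ≤ 1 := by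
    rw [hzdef, norm_mul, norm_natCast_cpow_of_pos (hp_pos n)]
    simpa using χ.norm_le_one (p n)
  have hsq : Summable fun n => ‖b n • z n‖ ^ 2 := by
    refine (summable_nat_add_one_rpow (r := -σ * 2) (by linarith)).of_nonneg_of_le
      (fun n => by positivity) fun n => ?_
    rw [Real.rpow_mul (by positivity), Real.rpow_two, norm_smul, Real.norm_of_nonneg (hb0 n)]
    gcongr
    exact (mul_le_of_le_one_right (hb0 n) (hznorm n)).trans (hb n)
  obtain ⟨L₀, hL₀⟩ := exists_tendsto_sum_smul_of_norm_sum_le_sqrt (z := z) hσ hanti hb0 hb hC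
  obtain ⟨L, hL⟩ := exists_tendsto_neg_sum_log_one_sub hL₀ hsq
  simp only [hbz] at hL
  refine ⟨L, hL, ?_⟩
  refine (hL.comp (tendsto_add_atTop_nat 1)).cesaro_smul.congr fun N => ?_
  rw [real_smul, ofReal_inv, ofReal_natCast]
  rfl
end

section
/- Let λ_1, …, λ_N be real numbers that are linearly independent over the rationals. Then lim_{T→∞} (1/T)·∫_0^T ( ∑_{n=1}^N cos(λ_n u) )⁴ du = 3N²/4 − 3N/8. -/
open Filter

/-- The time average of `u ↦ cos (a u)` is `1` if `a = 0` and `0` otherwise. -/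
theorem tendsto_average_cos (a : ℝ) :
    Tendsto (fun T : ℝ => (1 / T) * ∫ u in (0 : ℝ)..T, Real.cos (a * u)) atTop
      (nhds (if a = 0 then 1 else 0)) := by
  split_ifs with ha
  · refine tendsto_const_nhds.congr' ?_
    filter_upwards [eventually_gt_atTop 0] with T hT
    simp [ha, hT.ne']
  · refine squeeze_zero_norm' (a := fun T : ℝ => |a⁻¹| * T⁻¹) ?_ ?_
    · filter_upwards [eventually_gt_atTop 0] with T hT
      rw [intervalIntegral.integral_comp_mul_left _ ha, integral_cos]
      simp only [mul_zero, Real.sin_zero, sub_zero, smul_eq_mul, Real.norm_eq_abs, abs_mul,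
        one_div, abs_of_pos (inv_pos.2 hT)]
      have hs := mul_le_mul_of_nonneg_left (Real.abs_sin_le_one (a * T))
        (mul_nonneg (inv_pos.2 hT).le (abs_nonneg a⁻¹))
      linarith
    · simpa using tendsto_inv_atTop_zero.const_mul |a⁻¹|

/-- Time averages are additive over finite linear combinations of continuous functions. -/
theorem tendsto_average_sum {ι : Type*} (s : Finset ι) (c : ι → ℝ) (f : ι → ℝ → ℝ) (m : ι → ℝ)
    (hf : ∀ i ∈ s, Continuous (f i))
    (hm : ∀ i ∈ s, Tendsto (fun T : ℝ => (1 / T) * ∫ u in (0 : ℝ)..T, f i u) atTop (nhds (m i))) :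
    Tendsto (fun T : ℝ => (1 / T) * ∫ u in (0 : ℝ)..T, ∑ i ∈ s, c i * f i u) atTop
      (nhds (∑ i ∈ s, c i * m i)) := by
  refine (tendsto_finsetSum s fun i hi => (hm i hi).const_mul (c i)).congr fun T => ?_
  rw [intervalIntegral.integral_finsetSum
    fun i hi => ((hf i hi).const_mul (c i)).intervalIntegrable 0 T, Finset.mul_sum]
  refine Finset.sum_congr rfl fun i _ => ?_
  rw [intervalIntegral.integral_const_mul]
  ring

theorem cos_mul_cos_mul_cos_mul_cos (a b c d : ℝ) :
    Real.cos a * Real.cos b * Real.cos c * Real.cos d =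
      ∑ s : Fin 2 × Fin 2 × Fin 2,
        1 / 8 * Real.cos (a + (-1) ^ s.1.val * b + (-1) ^ s.2.1.val * c
          + (-1) ^ s.2.2.val * d) := by
  simp only [Fintype.sum_prod_type, Fin.sum_univ_two, Fin.val_zero, Fin.val_one, pow_zero, pow_one,
    one_mul, neg_mul, Real.cos_add, Real.sin_add, Real.cos_neg, Real.sin_neg]
  ring

theorem LinearIndependent.add_eq_add_iff {ι : Type*} {v : ι → ℝ} (hv : LinearIndependent ℚ v)
    (i j k l : ι) : v i + v j = v k + v l ↔ (i = k ∧ j = l) ∨ (i = l ∧ j = k) := by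
  constructor
  · intro h
    have h' : Finsupp.single i (1 : ℚ) + Finsupp.single j 1
        = Finsupp.single k 1 + Finsupp.single l 1 := by
      apply hv
      simpa using h
    rw [Finsupp.single_add_single_eq_single_add_single one_ne_zero one_ne_zero] at h'
    norm_num at h'
    tauto
  · rintro (⟨rfl, rfl⟩ | ⟨rfl, rfl⟩)
    · rfl
    · exact add_comm _ _

/-- An integral relation between four members of a linearly independent family has total
coefficient zero. -/
theorem LinearIndependent.coeff_sum_eq_zero {ι : Type*} {v : ι → ℝ} (hv : LinearIndependent ℚ v)
    {i j k l : ι} (p q r : ℤ) (h : v i + p * v j + q * v k + r * v l = 0) :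
    1 + p + q + r = 0 := by
  have h' : Finsupp.single i (1 : ℚ) + Finsupp.single j (p : ℚ) + Finsupp.single k (q : ℚ)
      + Finsupp.single l (r : ℚ) = 0 := by
    apply hv
    simpa [Rat.smul_def] using h
  have h'' := congrArg (Finsupp.linearCombination ℚ fun _ : ι => (1 : ℚ)) h'
  simp only [map_add, Finsupp.linearCombination_single, smul_eq_mul, mul_one, map_zero] at h''
  exact_mod_cast h''

theorem LinearIndependent.tendsto_average_cos_mul {ι : Type*} [DecidableEq ι] {v : ι → ℝ}
    (hv : LinearIndependent ℚ v) (i j k l : ι) :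
    Tendsto (fun T : ℝ => (1 / T) * ∫ u in (0 : ℝ)..T,
        Real.cos (v i * u) * Real.cos (v j * u) * Real.cos (v k * u) * Real.cos (v l * u))
      atTop (nhds (1 / 4 * ((if i = j then 1 else 0) * (if k = l then 1 else 0)
        + (if i = k then 1 else 0) * (if j = l then 1 else 0)
        + (if i = l then 1 else 0) * (if j = k then 1 else 0))
        - 3 / 8 * ((if i = j then 1 else 0) * ((if i = k then 1 else 0)
          * (if i = l then 1 else 0))))) := by
  have key := tendsto_average_sum (Finset.univ : Finset (Fin 2 × Fin 2 × Fin 2))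
    (fun _ => 1 / 8)
    (fun s u => Real.cos ((v i + (-1) ^ s.1.val * v j + (-1) ^ s.2.1.val * v k
      + (-1) ^ s.2.2.val * v l) * u)) _ (fun s _ => by fun_prop)
    (fun s _ => tendsto_average_cos _)
  convert key using 1
  · funext T
    congr 2
    funext u
    rw [cos_mul_cos_mul_cos_mul_cos]
    refine Finset.sum_congr rfl fun s _ => ?_
    ring_nf
  · congr 1
    have h₀ := fun p q r h => hv.coeff_sum_eq_zero (i := i) (j := j) (k := k) (l := l) p q r h
    have n₁ : ¬ (v i + v j + v k + v l = 0) := fun h => by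
      have := h₀ 1 1 1 (by push_cast; linarith)
      omega
    have n₂ : ¬ (v i + v j + v k + -v l = 0) := fun h => by
      have := h₀ 1 1 (-1) (by push_cast; linarith)
      omega
    have n₃ : ¬ (v i + v j + -v k + v l = 0) := fun h => by
      have := h₀ 1 (-1) 1 (by push_cast; linarith)
      omega
    have n₄ : ¬ (v i + -v j + v k + v l = 0) := fun h => by
      have := h₀ (-1) 1 1 (by push_cast; linarith)
      omega
    have n₅ : ¬ (v i + -v j + -v k + -v l = 0) := fun h => by
      have := h₀ (-1) (-1) (-1) (by push_cast; linarith)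
      omega
    have e₁ : v i + v j + -v k + -v l = 0 ↔ (i = k ∧ j = l) ∨ (i = l ∧ j = k) := by
      rw [← hv.add_eq_add_iff]
      constructor <;> intro h <;> linarith
    have e₂ : v i + -v j + v k + -v l = 0 ↔ (i = j ∧ k = l) ∨ (i = l ∧ k = j) := by
      rw [← hv.add_eq_add_iff]
      constructor <;> intro h <;> linarith
    have e₃ : v i + -v j + -v k + v l = 0 ↔ (i = j ∧ l = k) ∨ (i = k ∧ l = j) := by
      rw [← hv.add_eq_add_iff]
      constructor <;> intro h <;> linarith
    simp only [Fintype.sum_prod_type, Fin.sum_univ_two, Fin.val_zero, Fin.val_one, pow_zero,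
      pow_one, one_mul, neg_mul, n₁, n₂, n₃, n₄, n₅, e₁, e₂, e₃, if_false]
    clear h₀ n₁ n₂ n₃ n₄ n₅ e₁ e₂ e₃ key
    by_cases hij : i = j <;> by_cases hik : i = k <;> by_cases hil : i = l <;>
      by_cases hjk : j = k <;> by_cases hjl : j = l <;> by_cases hkl : k = l <;>
      first
        | (exfalso; grind)
        | (simp [hij, hik, hil, hjk, hjl, hkl, eq_comm (a := k) (b := j),
            eq_comm (a := l) (b := j), eq_comm (a := l) (b := k)]; try norm_num)

/-- if `λ 0, …, λ (N-1)` are real numbers linearly independent over ℚ, then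
`(1/T) ∫_0^T (∑ n cos(λ n · u))⁴ du → 3N²/4 - 3N/8` as `T → ∞`. -/
theorem stmt_6 (N : ℕ) (lam : Fin N → ℝ) (hind : LinearIndependent ℚ lam) :
    Tendsto (fun T : ℝ =>
        (1 / T) * ∫ u in (0 : ℝ)..T, (∑ n, Real.cos (lam n * u)) ^ 4)
      atTop (nhds (3 * (N : ℝ) ^ 2 / 4 - 3 * (N : ℝ) / 8)) := by
  have key := tendsto_average_sum (Finset.univ : Finset (Fin N × Fin N × Fin N × Fin N))
    (fun _ => 1)
    (fun s u => Real.cos (lam s.1 * u) * Real.cos (lam s.2.1 * u) * Real.cos (lam s.2.2.1 * u)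
      * Real.cos (lam s.2.2.2 * u)) _ (fun s _ => by fun_prop)
    (fun s _ => hind.tendsto_average_cos_mul s.1 s.2.1 s.2.2.1 s.2.2.2)
  convert key using 1
  · funext T
    congr 2
    funext u
    simp only [Fintype.sum_prod_type, one_mul, pow_succ, pow_zero, ← Finset.mul_sum,
      ← Finset.sum_mul]
  · congr 1
    simp only [Fintype.sum_prod_type, one_mul, Finset.sum_sub_distrib, Finset.sum_add_distrib,
      ← Finset.mul_sum]
    simp [apply_ite Finset.card]
    ring
end

section
/- Let χ be a non-principal Dirichlet character modulo k, and let L(s,χ) denote the associated Dirichlet L-function (the entire function that agrees with ∑_{n=1}^∞ χ(n) n^{-s} for Re(s) > 1). Let p_1 < p_2 < p_3 < … denote the sequence of prime numbers in increasing order. If there exists a constant C > 0 such that |∑_{n=1}^N χ(p_n)| ≤ C·√N for every N ≥ 1, then L(s,χ) ≠ 0 for every s with Re(s) > 1/2. -/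
open Complex Filter Topology Asymptotics MeasureTheory in
/-- If the partial sums of `f` are `O(n ^ r)` then the function `s * mellin S (-s)`, where `S` is
the summatory function of `f`, is holomorphic on `Re s > r`. -/
theorem differentiableAt_mul_mellin_sum_Icc {f : ℕ → ℂ} {r : ℝ} (hr : 0 ≤ r)
    (hO : (fun n ↦ ∑ k ∈ Finset.Icc 1 n, f k) =O[atTop] fun n ↦ (n : ℝ) ^ r)
    {s : ℂ} (hs : r < s.re) :
    DifferentiableAt ℂ
      (fun s ↦ s * mellin (fun t : ℝ ↦ ∑ k ∈ Finset.Icc 1 ⌊t⌋₊, f k) (-s)) s := by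
  have hloc : LocallyIntegrableOn (fun t : ℝ ↦ ∑ k ∈ Finset.Icc 1 ⌊t⌋₊, f k) (Set.Ioi 0) := by
    have := locallyIntegrableOn_mul_sum_Icc f (m := 1) le_rfl (g := fun _ ↦ (1 : ℂ))
      (continuous_const.locallyIntegrable.locallyIntegrableOn _)
    simpa using this.mono_set Set.Ioi_subset_Ici_self
  have htop : (fun t : ℝ ↦ ∑ k ∈ Finset.Icc 1 ⌊t⌋₊, f k) =O[atTop] fun t ↦ t ^ (-(-r)) := by
    rw [neg_neg]
    exact (hO.comp_tendsto tendsto_nat_floor_atTop).trans <|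
      isEquivalent_nat_floor.isBigO.rpow hr (eventually_ge_atTop 0)
  have hzero : (fun t : ℝ ↦ ∑ k ∈ Finset.Icc 1 ⌊t⌋₊, f k) =O[𝓝[>] 0]
      fun t ↦ t ^ (-(-s.re - 1)) := by
    have : (fun t : ℝ ↦ ∑ k ∈ Finset.Icc 1 ⌊t⌋₊, f k) =ᶠ[𝓝[>] 0] fun _ ↦ 0 := by
      filter_upwards [nhdsWithin_le_nhds (Iio_mem_nhds zero_lt_one)] with t ht
      rw [Nat.floor_eq_zero.mpr ht]
      simp
    exact this.trans_isBigO (isBigO_zero _ _)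
  have hd : DifferentiableAt ℂ (mellin fun t : ℝ ↦ ∑ k ∈ Finset.Icc 1 ⌊t⌋₊, f k) (-s) :=
    mellin_differentiableAt_of_isBigO_rpow hloc htop (by simpa using hs) hzero (by simp)
  exact differentiableAt_id.mul (DifferentiableAt.fun_comp' s hd differentiableAt_id.neg)

open Complex Filter Topology Asymptotics MeasureTheory in
theorem LSeries_eq_mul_mellin_sum_Icc {f : ℕ → ℂ} {r : ℝ} (hr : 0 ≤ r)
    (hO : (fun n ↦ ∑ k ∈ Finset.Icc 1 n, f k) =O[atTop] fun n ↦ (n : ℝ) ^ r)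
    {s : ℂ} (hs : r < s.re) (hS : LSeriesSummable f s) :
    LSeries f s = s * mellin (fun t : ℝ ↦ ∑ k ∈ Finset.Icc 1 ⌊t⌋₊, f k) (-s) := by
  rw [LSeries_eq_mul_integral f hr hs hS hO, mellin, ← integral_Ici_eq_integral_Ioi]
  congr 1
  symm
  calc _ = ∫ t in Set.Ici (1 : ℝ), (t : ℂ) ^ (-s - 1) • ∑ k ∈ Finset.Icc 1 ⌊t⌋₊, f k := by
        refine setIntegral_eq_of_subset_of_forall_sdiff_eq_zero measurableSet_Ioi
          (Set.Ici_subset_Ioi.mpr zero_lt_one) fun t ht ↦ ?_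
        rw [Nat.floor_eq_zero.mpr (not_le.mp ht.2)]
        simp
    _ = _ := by
        refine setIntegral_congr_fun measurableSet_Ici fun t _ ↦ ?_
        simp only [smul_eq_mul]
        rw [mul_comm, neg_add']

theorem sum_range_ite_eq_sum_range_nth {M : Type*} [AddCommMonoid M] (p : ℕ → Prop)
    [DecidablePred p] (g : ℕ → M) (m : ℕ) :
    ∑ k ∈ Finset.range m, (if p k then g k else 0) =
      ∑ n ∈ Finset.range (Nat.count p m), g (Nat.nth p n) := by
  induction m with
  | zero => simp
  | succ m ih =>
    rw [Finset.sum_range_succ, ih, Nat.count_succ]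
    by_cases h : p m
    · rw [if_pos h, if_pos h, Finset.sum_range_succ, Nat.nth_count h]
    · simp [h]

/-- A square-root bound for sums over the first `N` primes gives the exponent `1/2` for the
summatory function over primes up to `n`. -/
theorem isBigO_sum_primes_of_sum_nth_le {g : ℕ → ℂ} {C : ℝ} (hC : 0 ≤ C)
    (h : ∀ N : ℕ, 1 ≤ N →
      ‖∑ n ∈ Finset.range N, g (Nat.nth Nat.Prime n)‖ ≤ C * Real.sqrt N) :
    (fun n : ℕ ↦ ∑ k ∈ Finset.Icc 1 n, if k.Prime then g k else 0) =O[Filter.atTop]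
      fun n ↦ (n : ℝ) ^ (1 / 2 : ℝ) := by
  refine Asymptotics.IsBigO.of_bound C (Filter.Eventually.of_forall fun n ↦ ?_)
  have hsum : ∑ k ∈ Finset.Icc 1 n, (if k.Prime then g k else 0) =
      ∑ j ∈ Finset.range (Nat.count Nat.Prime (n + 1)), g (Nat.nth Nat.Prime j) := by
    rw [← sum_range_ite_eq_sum_range_nth, Nat.range_succ_eq_Icc_zero,
      ← Finset.insert_Icc_add_one_left_eq_Icc n.zero_le, Finset.sum_insert (by simp)]
    simp [Nat.not_prime_zero]
  have hcount : Nat.count Nat.Prime (n + 1) ≤ n := by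
    rw [Nat.count_succ']
    simpa [Nat.not_prime_zero] using Nat.count_le (fun k ↦ (k + 1).Prime) (n := n)
  rw [hsum, ← Real.sqrt_eq_rpow, Real.norm_of_nonneg (Real.sqrt_nonneg _)]
  rcases Nat.eq_zero_or_pos (Nat.count Nat.Prime (n + 1)) with h0 | h0
  · rw [h0]
    simpa using by positivity
  · refine (h _ h0).trans ?_
    gcongr

namespace DirichletCharacter

theorem norm_mul_prime_cpow_neg_le {k : ℕ} (χ : DirichletCharacter ℂ k) (p : Nat.Primes) {σ : ℝ}
    {s : ℂ} (hs : σ ≤ s.re) : ‖χ p * (p : ℂ) ^ (-s)‖ ≤ (p : ℝ) ^ (-σ) := by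
  have hp : (1 : ℝ) ≤ p := mod_cast p.prop.one_le
  rw [norm_mul, Complex.norm_natCast_cpow_of_pos p.prop.pos, Complex.neg_re]
  calc _ ≤ 1 * (p : ℝ) ^ (-s.re) := by gcongr; exact χ.norm_le_one _
    _ ≤ _ := by rw [one_mul]; gcongr

theorem norm_mul_prime_cpow_neg_lt_one {k : ℕ} (χ : DirichletCharacter ℂ k) (p : Nat.Primes)
    {s : ℂ} (hs : 0 < s.re) : ‖χ p * (p : ℂ) ^ (-s)‖ < 1 :=
  (χ.norm_mul_prime_cpow_neg_le p le_rfl).trans_lt <|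
    Real.rpow_lt_one_of_one_lt_of_neg (mod_cast p.prop.one_lt) (by linarith)

/-- The part of `∑ₚ -log (1 - χ(p) p⁻ˢ)` coming from proper prime powers. -/
noncomputable def logTail {k : ℕ} (χ : DirichletCharacter ℂ k) (s : ℂ) : ℂ :=
  ∑' p : Nat.Primes,
    (-Complex.log (1 - χ p * (p : ℂ) ^ (-s)) - χ p * (p : ℂ) ^ (-s))

theorem norm_logTail_term_le {k : ℕ} (χ : DirichletCharacter ℂ k) (p : Nat.Primes) {σ : ℝ}
    (hσ : 0 < σ) {s : ℂ} (hs : σ ≤ s.re) :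
    ‖-Complex.log (1 - χ p * (p : ℂ) ^ (-s)) - χ p * (p : ℂ) ^ (-s)‖ ≤
      (p : ℝ) ^ (-(2 * σ)) * ((1 - 2 ^ (-σ))⁻¹ / 2) := by
  set z := χ p * (p : ℂ) ^ (-s)
  have hp : (2 : ℝ) ≤ p := mod_cast p.prop.two_le
  have hz : ‖z‖ ≤ (p : ℝ) ^ (-σ) := χ.norm_mul_prime_cpow_neg_le p hs
  have h2 : (p : ℝ) ^ (-σ) ≤ 2 ^ (-σ) :=
    Real.rpow_le_rpow_of_nonpos two_pos hp (by linarith)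
  have h1 : (2 : ℝ) ^ (-σ) < 1 := Real.rpow_lt_one_of_one_lt_of_neg one_lt_two (by linarith)
  have hlog := Complex.norm_log_one_add_sub_self_le (z := -z) (by rw [norm_neg]; linarith)
  rw [norm_neg, ← sub_eq_add_neg, ← norm_neg] at hlog
  calc _ = ‖-(Complex.log (1 - z) - -z)‖ := by congr 1; ring
    _ ≤ _ := hlog
    _ ≤ ((p : ℝ) ^ (-σ)) ^ 2 * (1 - 2 ^ (-σ))⁻¹ / 2 := by
      have h0 : 0 < 1 - (2 : ℝ) ^ (-σ) := by linarith
      have hinv : (1 - ‖z‖)⁻¹ ≤ (1 - (2 : ℝ) ^ (-σ))⁻¹ :=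
        inv_anti₀ h0 (by linarith)
      have hinv0 : 0 ≤ (1 - ‖z‖)⁻¹ := inv_nonneg.mpr (by linarith)
      gcongr
    _ = _ := by
      rw [← Real.rpow_natCast, ← Real.rpow_mul (by positivity), mul_div_assoc]
      congr 2
      push_cast
      ring

theorem summable_logTail_bound {σ : ℝ} (hσ : 1 / 2 < σ) :
    Summable fun p : Nat.Primes ↦ (p : ℝ) ^ (-(2 * σ)) * ((1 - (2 : ℝ) ^ (-σ))⁻¹ / 2) :=
  (Nat.Primes.summable_rpow.mpr (by linarith)).mul_right _

theorem differentiableAt_logTail {k : ℕ} (χ : DirichletCharacter ℂ k) {s : ℂ}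
    (hs : 1 / 2 < s.re) : DifferentiableAt ℂ χ.logTail s := by
  obtain ⟨σ, hσ, hσs⟩ := exists_between hs
  have hU : IsOpen {w : ℂ | σ < w.re} := isOpen_lt continuous_const Complex.continuous_re
  refine (Complex.differentiableOn_tsum_of_summable_norm (summable_logTail_bound hσ)
    (fun p w hw ↦ ?_) hU fun p w hw ↦ χ.norm_logTail_term_le p (by linarith)
      (le_of_lt hw)).differentiableAt (hU.mem_nhds hσs)
  have hp : (p : ℂ) ≠ 0 := mod_cast p.prop.ne_zero
  have hpow : DifferentiableAt ℂ (fun w : ℂ ↦ χ p * (p : ℂ) ^ (-w)) w :=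
    (differentiableAt_id.neg.const_cpow (Or.inl hp)).const_mul _
  have hlt : ‖χ p * (p : ℂ) ^ (-w)‖ < 1 :=
    χ.norm_mul_prime_cpow_neg_lt_one p (by linarith [show σ < w.re from hw])
  have hslit : 1 - χ p * (p : ℂ) ^ (-w) ∈ Complex.slitPlane := by
    rw [sub_eq_add_neg]
    exact Complex.mem_slitPlane_of_norm_lt_one (by rwa [norm_neg])
  exact (((hpow.const_sub 1).clog hslit).neg.sub hpow).differentiableWithinAt

theorem LSeriesSummable_primes {k : ℕ} (χ : DirichletCharacter ℂ k) {s : ℂ} (hs : 1 < s.re) :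
    LSeriesSummable (fun n : ℕ ↦ if n.Prime then χ n else 0) s := by
  refine LSeriesSummable_of_bounded_of_one_lt_re (m := 1) (fun n _ ↦ ?_) hs
  split_ifs
  · exact χ.norm_le_one _
  · simp

theorem hasSum_LSeries_primes {k : ℕ} (χ : DirichletCharacter ℂ k) {s : ℂ} (hs : 1 < s.re) :
    HasSum (fun p : Nat.Primes ↦ χ p * (p : ℂ) ^ (-s))
      (LSeries (fun n : ℕ ↦ if n.Prime then χ n else 0) s) := by
  have h := (χ.LSeriesSummable_primes hs).LSeriesHasSum
  rw [LSeriesHasSum, ← hasSum_subtype_iff_of_support_subset (s := {n | n.Prime})] at h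
  · refine h.congr_fun fun p ↦ ?_
    have hp : (p : ℕ).Prime := p.2
    simp [hp, hp.ne_zero, Complex.cpow_neg, div_eq_mul_inv]
  · intro n hn
    contrapose! hn
    simp [LSeries.term_def, show ¬ n.Prime from hn]

theorem LFunction_eq_exp_LSeries_primes {k : ℕ} [NeZero k] (χ : DirichletCharacter ℂ k) {s : ℂ}
    (hs : 1 < s.re) :
    LFunction χ s = Complex.exp
      (LSeries (fun n : ℕ ↦ if n.Prime then χ n else 0) s + χ.logTail s) := by
  have htail : Summable fun p : Nat.Primes ↦
      (-Complex.log (1 - χ p * (p : ℂ) ^ (-s)) - χ p * (p : ℂ) ^ (-s)) :=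
    .of_norm_bounded (summable_logTail_bound (σ := s.re) (by linarith))
      fun p ↦ χ.norm_logTail_term_le p (by linarith) le_rfl
  rw [LFunction_eq_LSeries χ hs, ← LSeries_eulerProduct_exp_log χ hs, logTail,
    ← ((χ.hasSum_LSeries_primes hs).add htail.hasSum).tsum_eq]
  simp

end DirichletCharacter

/-- let `χ` be a non-principal Dirichlet character mod `k` and
`DirichletCharacter.LFunction χ` its L-function (entire, agreeing with `∑ χ(n) n^{-s}`
for `Re s > 1`).  With `p n = Nat.nth Nat.Prime n` the increasing sequence of primes,
if `‖∑_{n<N} χ(p n)‖ ≤ C √N` for all `N ≥ 1` and some `C > 0`, then `L(s,χ) ≠ 0`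
for every `s` with `Re s > 1/2`. -/
theorem stmt_13 {k : ℕ} [NeZero k] (χ : DirichletCharacter ℂ k) (hχ : χ ≠ 1)
    (hbound : ∃ C : ℝ, 0 < C ∧ ∀ N : ℕ, 1 ≤ N →
      ‖∑ n ∈ Finset.range N, χ (Nat.nth Nat.Prime n)‖ ≤ C * Real.sqrt N) :
    ∀ s : ℂ, 1 / 2 < s.re → DirichletCharacter.LFunction χ s ≠ 0 := by
  obtain ⟨C, hC, hb⟩ := hbound
  have hO := isBigO_sum_primes_of_sum_nth_le (g := fun n ↦ χ n) hC.le hb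
  set f : ℕ → ℂ := fun n ↦ if n.Prime then χ n else 0
  set E : ℂ → ℂ := fun s ↦
    Complex.exp (s * mellin (fun t : ℝ ↦ ∑ k ∈ Finset.Icc 1 ⌊t⌋₊, f k) (-s) + χ.logTail s)
  have hU : IsOpen {w : ℂ | 1 / 2 < w.re} := isOpen_lt continuous_const Complex.continuous_re
  have hE : DifferentiableOn ℂ E {w : ℂ | 1 / 2 < w.re} := fun w hw ↦
    ((differentiableAt_mul_mellin_sum_Icc (by norm_num) hO hw).add
      (χ.differentiableAt_logTail hw)).cexp.differentiableWithinAt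
  have heq : χ.LFunction =ᶠ[nhds 2] E := by
    filter_upwards [(isOpen_lt continuous_const Complex.continuous_re).mem_nhds
      (show (1 : ℝ) < (2 : ℂ).re by norm_num)] with w hw
    have hw' : 1 < w.re := hw
    rw [χ.LFunction_eq_exp_LSeries_primes hw', LSeries_eq_mul_mellin_sum_Icc (by norm_num) hO
      (by linarith) (χ.LSeriesSummable_primes hw')]
  have hEqOn : Set.EqOn χ.LFunction E {w : ℂ | 1 / 2 < w.re} :=
    ((DirichletCharacter.differentiable_LFunction hχ).differentiableOn.analyticOnNhd
      hU).eqOn_of_preconnected_of_eventuallyEq (hE.analyticOnNhd hU)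
      (convex_halfSpace_re_gt _).isPreconnected
      (show (1 / 2 : ℝ) < (2 : ℂ).re by norm_num) heq
  intro s hs
  rw [hEqOn hs]
  exact Complex.exp_ne_zero _
end

section
/- For every real s > 1, the prime zeta function satisfies the identity ∑_p p^{-s} = ∑_{n=1}^∞ (μ(n)/n)·log ζ(n·s), where the sum on the left runs over all primes p, μ is the Möbius function, ζ is the Riemann zeta function (whose values ζ(ns) are real and greater than 1 for ns > 1), log is the real logarithm, and the series on the right converges absolutely. -/
open ArithmeticFunction in
/-- The Lambert-type expansion `∑ₙ (μ(n)/n) · (-log (1 - xⁿ)) = x` for `|x| < 1`. -/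
theorem hasSum_moebius_div_mul_neg_log_one_sub_pow {x : ℝ} (hx : |x| < 1) :
    HasSum (fun n : ℕ+ ↦ (moebius n : ℝ) / n * -Real.log (1 - x ^ (n : ℕ))) x := by
  let F : ℕ+ × ℕ+ → ℝ := fun c ↦ (moebius c.1 : ℝ) / (c.1 * c.2) * x ^ (c.1 * c.2 : ℕ)
  have hF : Summable F := by
    refine Summable.of_norm_bounded
      (by simpa using summable_prod_mul_pow 0 (r := |x|) (by simpa)) fun c ↦ ?_
    have hmu : |(moebius c.1 : ℝ)| ≤ 1 := by exact_mod_cast abs_moebius_le_one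
    have h1 : (1 : ℝ) ≤ c.1 := by exact_mod_cast (one_le : 1 ≤ c.1)
    have h2 : (1 : ℝ) ≤ c.2 := by exact_mod_cast (one_le : 1 ≤ c.2)
    have h3 : (1 : ℝ) ≤ c.1 * c.2 := one_le_mul_of_one_le_of_one_le h1 h2
    rw [Real.norm_eq_abs, abs_mul, abs_pow, abs_div,
      abs_of_pos (by positivity : (0 : ℝ) < c.1 * c.2)]
    refine mul_le_of_le_one_left (by positivity) ?_
    exact div_le_one_of_le₀ (hmu.trans h3) (by positivity)
  have hrow (n : ℕ+) :
      HasSum (fun m : ℕ+ ↦ F (n, m)) ((moebius n : ℝ) / n * -Real.log (1 - x ^ (n : ℕ))) := by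
    have hlt : |x ^ (n : ℕ)| < 1 := by
      rw [abs_pow]
      exact pow_lt_one₀ (abs_nonneg _) hx n.ne_zero
    have h := (Equiv.pnatEquivNat.hasSum_iff.mpr
      (Real.hasSum_pow_div_log_of_abs_lt_one hlt)).mul_left ((moebius n : ℝ) / n)
    convert! h using 2 with m
    have hm : (m.natPred : ℝ) + 1 = m := by exact_mod_cast m.natPred_add_one
    simp only [F, Function.comp_apply, Equiv.pnatEquivNat_apply, PNat.natPred_add_one, hm, pow_mul]
    ring
  have hdiv (k : ℕ+) : HasSum (fun d : (k : ℕ).divisorsAntidiagonal ↦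
      F (sigmaAntidiagonalEquivProd ⟨k, d⟩)) (if k = 1 then x else 0) := by
    convert hasSum_fintype _ using 1
    have hterm (d : (k : ℕ).divisorsAntidiagonal) :
        F (sigmaAntidiagonalEquivProd ⟨k, d⟩) = x ^ (k : ℕ) / k * (moebius d.1.1 : ℝ) := by
      have hk : (d.1.1 : ℕ) * d.1.2 = k := (Nat.mem_divisorsAntidiagonal.mp d.2).1
      have hk' : ((d.1.1 : ℕ) : ℝ) * d.1.2 = (k : ℕ) := by exact_mod_cast hk
      simp only [F, sigmaAntidiagonalEquivProd, divisorsAntidiagonalFactors, Equiv.coe_fn_mk,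
        PNat.mk_coe, hk, hk']
      ring
    simp only [hterm, ← Finset.mul_sum]
    rw [Finset.univ_eq_attach,
      (k : ℕ).divisorsAntidiagonal.sum_attach fun d : ℕ × ℕ ↦ (moebius d.1 : ℝ),
      Nat.sum_divisorsAntidiagonal fun i _ ↦ (moebius i : ℝ)]
    have := congrArg (fun f : ArithmeticFunction ℤ ↦ f k) moebius_mul_coe_zeta
    rw [coe_mul_zeta_apply, one_apply] at this
    rw [← Int.cast_sum, this]
    by_cases hk : k = 1
    · simp [hk]
    · simp [hk]
  have htotal : HasSum F x := by
    have h := (sigmaAntidiagonalEquivProd.hasSum_iff.mpr hF.hasSum).sigma hdiv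
    have := h.unique (hasSum_ite_eq (1 : ℕ+) x)
    exact this ▸ hF.hasSum
  exact htotal.prod_fiberwise hrow

/-- The logarithm of the Euler product of `ζ` at a real `t > 1`. -/
theorem hasSum_primes_neg_log_one_sub_rpow {t : ℝ} (ht : 1 < t) :
    HasSum (fun p : Nat.Primes ↦ -Real.log (1 - (p : ℝ) ^ (-t)))
      (Real.log (riemannZeta (t : ℂ)).re) := by
  have hcast (p : Nat.Primes) :
      -Complex.log (1 - (p : ℂ) ^ (-(t : ℂ))) = (-Real.log (1 - (p : ℝ) ^ (-t)) : ℝ) := by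
    have hle : (p : ℝ) ^ (-t) ≤ 1 :=
      Real.rpow_le_one_of_one_le_of_nonpos (mod_cast p.2.one_le) (by linarith)
    rw [Complex.ofReal_neg, Complex.ofReal_log (by linarith), Complex.ofReal_sub,
      Complex.ofReal_cpow (by positivity)]
    simp
  have hsum : Summable fun p : Nat.Primes ↦ -Real.log (1 - (p : ℝ) ^ (-t)) := by
    have h : Summable fun p : Nat.Primes ↦ (p : ℝ) ^ (-t) :=
      Nat.Primes.summable_rpow.mpr (by linarith)
    have h' := (Complex.summable_ofReal.mpr h).clog_one_sub.neg
    refine Complex.summable_ofReal.mp (h'.congr fun p ↦ ?_)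
    rw [← hcast, Complex.ofReal_cpow (by positivity)]
    simp
  have hexp := riemannZeta_eulerProduct_exp_log (s := t) (by simpa using ht)
  simp only [hcast] at hexp
  rw [← Complex.ofReal_tsum, ← Complex.ofReal_exp] at hexp
  rw [← hexp, Complex.ofReal_re, Real.log_exp]
  exact hsum.hasSum

theorem neg_log_one_sub_le_two_mul {y : ℝ} (h0 : 0 ≤ y) (h1 : y ≤ 1 / 2) :
    -Real.log (1 - y) ≤ 2 * y := by
  have hy : 0 < 1 - y := by linarith
  have h := Real.one_sub_inv_le_log_of_pos hy
  have h' : (1 - y)⁻¹ ≤ 1 + 2 * y := by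
    rw [inv_le_iff_one_le_mul₀ hy]
    nlinarith
  linarith

theorem Nat.Primes.rpow_neg_le_half {s : ℝ} (hs : 1 ≤ s) (p : Nat.Primes) :
    (p : ℝ) ^ (-s) ≤ 1 / 2 := by
  have hp : (2 : ℝ) ≤ p := mod_cast p.2.two_le
  calc (p : ℝ) ^ (-s) ≤ (p : ℝ) ^ (-1 : ℝ) :=
        Real.rpow_le_rpow_of_exponent_le (by linarith) (by linarith)
    _ ≤ 1 / 2 := by
        rw [Real.rpow_neg_one, one_div]
        exact inv_anti₀ two_pos hp

open ArithmeticFunction in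
theorem summable_primes_moebius_div_mul_neg_log {s : ℝ} (hs : 1 < s) :
    Summable fun c : Nat.Primes × ℕ+ ↦
      (moebius c.2 : ℝ) / c.2 * -Real.log (1 - ((c.1 : ℝ) ^ (-s)) ^ (c.2 : ℕ)) := by
  have hpos (p : Nat.Primes) : (0 : ℝ) ≤ (p : ℝ) ^ (-s) := by positivity
  have hgeom (p : Nat.Primes) : HasSum (fun n : ℕ+ ↦ 2 * ((p : ℝ) ^ (-s)) ^ (n : ℕ))
      (2 * ((p : ℝ) ^ (-s) * (1 - (p : ℝ) ^ (-s))⁻¹)) := by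
    have hlt : (p : ℝ) ^ (-s) < 1 := (p.rpow_neg_le_half hs.le).trans_lt (by norm_num)
    have h := ((hasSum_geometric_of_lt_one (hpos p) hlt).mul_left ((p : ℝ) ^ (-s))).mul_left 2
    convert! (Equiv.pnatEquivNat.hasSum_iff.mpr h) using 2 with n
    simp [← pow_succ']
  have hbound : Summable fun c : Nat.Primes × ℕ+ ↦ 2 * ((c.1 : ℝ) ^ (-s)) ^ (c.2 : ℕ) := by
    rw [summable_prod_of_nonneg fun c ↦ by have := hpos c.1; positivity]
    refine ⟨fun p ↦ (hgeom p).summable, ?_⟩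
    simp only [(hgeom _).tsum_eq]
    refine Summable.of_nonneg_of_le (fun p ↦ ?_) (fun p ↦ ?_)
      ((Nat.Primes.summable_rpow.mpr (by linarith : -s < -1)).mul_left 4)
    · have := p.rpow_neg_le_half hs.le
      exact mul_nonneg two_pos.le (mul_nonneg (hpos p) (inv_nonneg.mpr (by linarith)))
    · have h := p.rpow_neg_le_half hs.le
      have h2 : (1 - (p : ℝ) ^ (-s))⁻¹ ≤ 2 := by
        rw [inv_le_iff_one_le_mul₀ (by linarith)]
        linarith
      nlinarith [hpos p]
  refine Summable.of_norm_bounded hbound fun c ↦ ?_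
  have hy0 : 0 ≤ ((c.1 : ℝ) ^ (-s)) ^ (c.2 : ℕ) := pow_nonneg (hpos _) _
  have hhalf := c.1.rpow_neg_le_half hs.le
  have hy1 : ((c.1 : ℝ) ^ (-s)) ^ (c.2 : ℕ) ≤ 1 / 2 :=
    (pow_le_of_le_one (hpos _) (by linarith) c.2.ne_zero).trans hhalf
  have hlog : 0 ≤ -Real.log (1 - ((c.1 : ℝ) ^ (-s)) ^ (c.2 : ℕ)) :=
    neg_nonneg.mpr (Real.log_nonpos (by linarith) (by linarith))
  have hmu : |(moebius c.2 : ℝ)| ≤ 1 := by exact_mod_cast abs_moebius_le_one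
  have h1 : (1 : ℝ) ≤ c.2 := by exact_mod_cast (one_le : 1 ≤ c.2)
  rw [Real.norm_eq_abs, abs_mul, abs_of_nonneg hlog, abs_div, Nat.abs_cast]
  exact (mul_le_of_le_one_left hlog (div_le_one_of_le₀ (hmu.trans h1) (by positivity))).trans
    (neg_log_one_sub_le_two_mul hy0 hy1)

open ArithmeticFunction in
theorem hasSum_moebius_div_mul_log_riemannZeta {s : ℝ} (hs : 1 < s) :
    HasSum (fun n : ℕ+ ↦
        (moebius n : ℝ) / n * Real.log (riemannZeta (((n : ℕ) : ℂ) * (s : ℂ))).re)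
      (∑' p : Nat.Primes, (p : ℝ) ^ (-s)) := by
  have hF := summable_primes_moebius_div_mul_neg_log hs
  have hprime := hF.hasSum.prod_fiberwise fun p ↦
    hasSum_moebius_div_mul_neg_log_one_sub_pow (x := (p : ℝ) ^ (-s)) (by
      rw [abs_of_nonneg (by positivity)]
      exact (p.rpow_neg_le_half hs.le).trans_lt (by norm_num))
  rw [hprime.tsum_eq]
  refine ((Equiv.prodComm ℕ+ Nat.Primes).hasSum_iff.mpr hF.hasSum).prod_fiberwise fun n ↦ ?_
  have hn : (1 : ℝ) ≤ n := by exact_mod_cast (one_le : 1 ≤ n)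
  have h := hasSum_primes_neg_log_one_sub_rpow (t := n * s) (by nlinarith)
  rw [Complex.ofReal_mul, Complex.ofReal_natCast] at h
  convert! (h.mul_left ((moebius n : ℝ) / n)) using 2 with p
  simp only [Function.comp_apply, Equiv.prodComm_apply, Prod.swap_prod_mk]
  rw [← Real.rpow_mul_natCast (by positivity), neg_mul, mul_comm s]

/-- for real `s > 1`, the prime zeta function satisfies
`∑_p p^{-s} = ∑_{n≥1} (μ(n)/n) log ζ(ns)`, where `μ` is the Möbius function, the values
`ζ(ns)` are real (we take the real part) and `> 1`, `log` is the real logarithm, and the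
series on the right converges absolutely.  (The index `n` ranges over `n+1`, `n : ℕ`.) -/
theorem stmt_15 (s : ℝ) (hs : 1 < s) :
    (Summable fun n : ℕ =>
      |((ArithmeticFunction.moebius (n + 1) : ℝ) / (n + 1)) *
        Real.log ((riemannZeta (((n + 1 : ℕ) : ℂ) * (s : ℂ))).re)|) ∧
    HasSum (fun n : ℕ =>
        ((ArithmeticFunction.moebius (n + 1) : ℝ) / (n + 1)) *
          Real.log ((riemannZeta (((n + 1 : ℕ) : ℂ) * (s : ℂ))).re))
      (∑' p : Nat.Primes, (p : ℝ) ^ (-s)) := by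
  have h := Equiv.pnatEquivNat.symm.hasSum_iff.mpr (hasSum_moebius_div_mul_log_riemannZeta hs)
  have h' : HasSum (fun n : ℕ =>
        ((ArithmeticFunction.moebius (n + 1) : ℝ) / (n + 1)) *
          Real.log ((riemannZeta (((n + 1 : ℕ) : ℂ) * (s : ℂ))).re))
      (∑' p : Nat.Primes, (p : ℝ) ^ (-s)) := by
    convert! h using 2 with n
    simp
  exact ⟨h'.summable.abs, h'⟩
end
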